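/- Let K be a field of characteristic zero and n ≥ 1 an integer. Let M be the free K-vector space with basis {f_k : k ≥ 0} ∪ {e_k : k ≥ 0}, b : M → M the K-linear map with b(f_k) = 0, b(e_k) = f_{k−n} for k ≥ n and b(e_k) = 0 for k < n, and B : M → M the K-linear map with B(f_k) = 0 and B(e_k) = (k+1) f_{k+1}. Fix 0 ≤ k ≤ n−1 and let s_k = Σ_{l≥0} (−1)^l c_{k,l} e_{k+(n+1)l} u^l ∈ M[[u]], where c_{k,0} = 1 and c_{k,l} = ∏_{j=0}^{l−1} (k + 1 + j(n+1)). Suppose x = Σ_{l≥0} x_l u^l ∈ M[[u]] satisfies: (i) (b + uB)(x) = 0; (ii) each coefficient x_l ∈ M is homogeneous of weight (2k+1−n)/(n+1) + 2l with respect to the weights wt(f_m) = 2m/(n+1), wt(e_m) = (2m+1−n)/(n+1); (iii) x_0 − e_k lies in the image of b. Then x − s_k lies in the image of the operator b + uB acting on M[[u]]. -/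

import Mathlib

set_option maxHeartbeats 8000000
set_option synthInstance.maxHeartbeats 8000000

noncomputable section

open Finsupp

/-- The reduced Hochschild chain complex of `A_n` as a free vector space:
`Sum.inl k` indexes the even basis vector `f_k = 1|ε^k`,
`Sum.inr k` indexes the odd basis vector `e_k = ε|ε^k`. -/
abbrev MM (K : Type*) [Field K] := (ℕ ⊕ ℕ) →₀ K

/-- The even basis vectors `f_k`. -/
def fv (K : Type*) [Field K] (k : ℕ) : MM K := Finsupp.single (Sum.inl k) 1

/-- The odd basis vectors `e_k`. -/
def ev (K : Type*) [Field K] (k : ℕ) : MM K := Finsupp.single (Sum.inr k) 1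

/-- The Hochschild differential: `b f_k = 0`, `b e_k = f_{k-n}` if `k ≥ n`, else `0`. -/
def bmap (K : Type*) [Field K] (n : ℕ) : MM K →ₗ[K] MM K :=
  Finsupp.linearCombination K
    (Sum.elim (fun _ => (0 : MM K)) (fun k => if n ≤ k then fv K (k - n) else 0))

/-- The Connes cyclic operator: `B f_k = 0`, `B e_k = (k+1) f_{k+1}`. -/
def Bmap (K : Type*) [Field K] : MM K →ₗ[K] MM K :=
  Finsupp.linearCombination K
    (Sum.elim (fun _ => (0 : MM K)) (fun k => ((k : K) + 1) • fv K (k + 1)))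

/-- The coefficients `c_{k,l} = ∏_{j=0}^{l-1} (k + 1 + j(n+1))`, with `c_{k,0} = 1`. -/
def cc (n k l : ℕ) : ℕ := ∏ j ∈ Finset.range l, (k + 1 + j * (n + 1))

/-- The element `s_k = Σ_{l≥0} (−1)^l c_{k,l} e_{k+(n+1)l} u^l ∈ M[[u]]`,
where an element of `M[[u]]` is recorded by its sequence of coefficients. -/
def sElt (K : Type*) [Field K] (n k : ℕ) : ℕ → MM K :=
  fun l => ((-1 : K) ^ l * (cc n k l : K)) • ev K (k + (n + 1) * l)

/-- The operator `b + uB` on `M[[u]]`, acting on sequences of coefficients. -/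
def Dop (K : Type*) [Field K] (n : ℕ) : (ℕ → MM K) → (ℕ → MM K) :=
  fun x l => bmap K n (x l) + (if l = 0 then 0 else Bmap K (x (l - 1)))

/-- The weights of the basis vectors: `wt f_m = 2m/(n+1)`, `wt e_m = (2m+1−n)/(n+1)`. -/
def wtB (n : ℕ) : (ℕ ⊕ ℕ) → ℚ :=
  Sum.elim (fun m => 2 * m / (n + 1)) (fun m => (2 * m + 1 - n) / (n + 1))

/-- An element of `M` is homogeneous of weight `w` if it is supported on
basis vectors of weight `w`. -/
def IsHomog (K : Type*) [Field K] (n : ℕ) (x : MM K) (w : ℚ) : Prop :=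
  ∀ i, x i ≠ 0 → wtB n i = w

theorem bmap_apply_inl {K : Type*} [Field K] (n : ℕ) (x : MM K) (j : ℕ) :
    bmap K n x (Sum.inl j) = x (Sum.inr (j + n)) := by
  induction x using Finsupp.induction_linear with
  | zero => simp
  | add p q hp hq => simp [hp, hq]
  | single i a =>
    rcases i with i | i
    · simp [bmap]
    · by_cases h : n ≤ i
      · simp [bmap, fv, h, Finsupp.single_apply, Nat.sub_eq_iff_eq_add h]
      · have h' : i ≠ j + n := by omega
        simp [bmap, h, h']

theorem bmap_apply_inr {K : Type*} [Field K] (n : ℕ) (x : MM K) (j : ℕ) :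
    bmap K n x (Sum.inr j) = 0 := by
  induction x using Finsupp.induction_linear with
  | zero => simp
  | add p q hp hq => simp [hp, hq]
  | single i a =>
    rcases i with i | i
    · simp [bmap]
    · by_cases h : n ≤ i <;> simp [bmap, fv, h]

theorem Bmap_apply_inl_succ {K : Type*} [Field K] (x : MM K) (j : ℕ) :
    Bmap K x (Sum.inl (j + 1)) = ((j : K) + 1) * x (Sum.inr j) := by
  induction x using Finsupp.induction_linear with
  | zero => simp
  | add p q hp hq => simp [hp, hq, mul_add]
  | single i a =>
    rcases i with i | i
    · simp [Bmap]
    · by_cases h : i = j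
      · simp [Bmap, fv, h]
        ring
      · simp [Bmap, fv, h]

theorem Bmap_apply_inr {K : Type*} [Field K] (x : MM K) (j : ℕ) :
    Bmap K x (Sum.inr j) = 0 := by
  induction x using Finsupp.induction_linear with
  | zero => simp
  | add p q hp hq => simp [hp, hq]
  | single i a => rcases i with i | i <;> simp [Bmap, fv]

/-- The image of `b` is the whole span of the even basis vectors. -/
theorem exists_bmap_eq {K : Type*} [Field K] (n : ℕ) (z : MM K)
    (hz : ∀ j, z (Sum.inr j) = 0) : ∃ y, bmap K n y = z := by
  refine ⟨Finsupp.linearCombination K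
    (Sum.elim (fun j => ev K (j + n)) (fun _ => (0 : MM K))) z, ?_⟩
  ext (j | j)
  · rw [bmap_apply_inl]
    clear hz
    induction z using Finsupp.induction_linear with
    | zero => simp
    | add p q hp hq => simp [hp, hq]
    | single i a => rcases i with i | i <;> simp [ev, Finsupp.single_apply]
  · rw [bmap_apply_inr, hz]

/-- Every even element of `M[[u]]` lies in the image of `b + uB`. -/
theorem exists_eq_Dop {K : Type*} [Field K] (n : ℕ) (z : ℕ → MM K)
    (hz : ∀ l j, z l (Sum.inr j) = 0) : ∃ y, z = Dop K n y := by
  have hsucc : ∀ (l : ℕ) (w : MM K), ∃ y, bmap K n y = z (l + 1) - Bmap K w := fun l w =>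
    exists_bmap_eq n _ fun j => by simp [hz, Bmap_apply_inr]
  obtain ⟨y₀, hy₀⟩ := exists_bmap_eq n (z 0) (hz 0)
  choose g hg using hsucc
  refine ⟨fun l => Nat.rec y₀ g l, ?_⟩
  funext l
  cases l with
  | zero => simp [Dop, hy₀]
  | succ l => simp [Dop, hg]

theorem IsHomog.apply_inr_eq_zero {K : Type*} [Field K] {n k l : ℕ} {x : MM K}
    (hx : IsHomog K n x ((2 * k + 1 - n) / (n + 1) + 2 * l)) {m : ℕ}
    (hm : m ≠ k + (n + 1) * l) : x (Sum.inr m) = 0 := by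
  by_contra h
  have hw := hx _ h
  have hn : (n : ℚ) + 1 ≠ 0 := by positivity
  simp only [wtB, Sum.elim_inr] at hw
  field_simp at hw
  apply hm
  have hq : (m : ℚ) = k + (n + 1) * l := by linarith
  exact_mod_cast hq

/-- The odd part of a cocycle satisfies the recursion which determines `s_k`. -/
theorem apply_inr_succ_of_Dop_eq_zero {K : Type*} [Field K] {n : ℕ} {x : ℕ → MM K}
    (hx : Dop K n x = 0) (l m : ℕ) :
    x (l + 1) (Sum.inr (m + (n + 1))) = -(((m : K) + 1) * x l (Sum.inr m)) := by
  have h := DFunLike.congr_fun (congrFun hx (l + 1)) (Sum.inl (m + 1))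
  simp only [Dop, Nat.add_eq_zero_iff, one_ne_zero, and_false, if_false, Nat.add_sub_cancel,
    Finsupp.add_apply, bmap_apply_inl, Bmap_apply_inl_succ, Pi.zero_apply,
    Finsupp.zero_apply] at h
  rw [show m + (n + 1) = m + 1 + n by ring]
  exact eq_neg_of_add_eq_zero_left h

theorem stmt3 (K : Type*) [Field K] [CharZero K] (n : ℕ) (hn : 1 ≤ n)
    (k : ℕ) (hk : k ≤ n - 1) (x : ℕ → MM K)
    -- (i) (b + uB)(x) = 0
    (h1 : Dop K n x = 0)
    -- (ii) each coefficient x_l is homogeneous of weight (2k+1−n)/(n+1) + 2l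
    (h2 : ∀ l : ℕ, IsHomog K n (x l) ((2 * k + 1 - n) / (n + 1) + 2 * l))
    -- (iii) x_0 − e_k lies in the image of b
    (h3 : x 0 - ev K k ∈ LinearMap.range (bmap K n)) :
    -- then x − s_k lies in the image of b + uB acting on M[[u]]
    ∃ y : ℕ → MM K, (fun l => x l - sElt K n k l) = Dop K n y := by
  have hlead : ∀ l, x l (Sum.inr (k + (n + 1) * l)) = (-1 : K) ^ l * (cc n k l : K) := by
    intro l
    induction l with
    | zero =>
      obtain ⟨y, hy⟩ := h3
      have h := DFunLike.congr_fun hy (Sum.inr k)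
      rw [bmap_apply_inr] at h
      simpa [cc, ev] using (sub_eq_zero.mp h.symm)
    | succ l ih =>
      rw [show k + (n + 1) * (l + 1) = k + (n + 1) * l + (n + 1) by ring,
        apply_inr_succ_of_Dop_eq_zero h1, ih, cc, cc, Finset.prod_range_succ]
      push_cast
      ring
  refine exists_eq_Dop n _ fun l j => ?_
  by_cases hj : j = k + (n + 1) * l
  · subst hj
    simp [sElt, ev, hlead]
  · simp [sElt, ev, (h2 l).apply_inr_eq_zero hj, Ne.symm hj]
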